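/- Let n ≥ 1 and 0 < p < p_n*, where p_n* = ∞ for n = 1,2 and p_n* = 4/(n-2) for n ≥ 3. There is no smooth solution u : ℝ × ℝⁿ → ℂ of the focusing NLS i∂_t u + Δ_x u = -|u|^p u which is exponentially localized (there exist C, γ > 0 with |∂^α u(t,x)| ≤ C e^{-γ|x|} for all (t,x) and all space-time derivatives ∂^α of order at most 2), time-periodic with some period T > 0, has zero momentum P[u](0) = 0, and lies in one of the following regimes: (1) E[u](0) > 0 and p ≤ 4/n; (2) E[u](0) = 0, p ≠ 4/n, and u is not identically zero; (3) E[u](0) < 0 and 4/n ≤ p. -/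

import Mathlib

open MeasureTheory Real Complex Function

/-- Partial derivative in the `j`-th coordinate direction. -/
noncomputable def pd {n : ℕ} (f : EuclideanSpace ℝ (Fin n) → ℂ) (j : Fin n)
    (x : EuclideanSpace ℝ (Fin n)) : ℂ :=
  fderiv ℝ f x (EuclideanSpace.single j 1)

/-- Spatial Laplacian. -/
noncomputable def lap {n : ℕ} (f : EuclideanSpace ℝ (Fin n) → ℂ)
    (x : EuclideanSpace ℝ (Fin n)) : ℂ :=
  ∑ j, pd (fun y => pd f j y) j x

/-- Energy of a solution of the focusing NLS (ε = -1) at time `0`: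
`E[u] = ‖∇u‖²_{L²} - (2/(p+2)) ‖u‖^{p+2}_{L^{p+2}}`. -/
noncomputable def focusingEnergy {n : ℕ} (p : ℝ) (u : ℝ → EuclideanSpace ℝ (Fin n) → ℂ) : ℝ :=
  (∫ x, ∑ j, ‖pd (u 0) j x‖ ^ 2) - (2 / (p + 2)) * ∫ x, ‖u 0 x‖ ^ (p + 2)

/-- A function on space-time decays faster than any power of `‖x‖`, uniformly in time. -/
def RapidDecay {n : ℕ} {F : Type*} [NormedAddCommGroup F]
    (f : ℝ × EuclideanSpace ℝ (Fin n) → F) : Prop :=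
  ∀ N : ℕ, ∃ C : ℝ, ∀ w, (1 + ‖w.2‖) ^ N * ‖f w‖ ≤ C

/-- A `C¹` function on space-time that decays rapidly together with its derivative. -/
structure RapidDecayC1 {n : ℕ} {F : Type*} [NormedAddCommGroup F] [NormedSpace ℝ F]
    (f : ℝ × EuclideanSpace ℝ (Fin n) → F) : Prop where
  contDiff : ContDiff ℝ 1 f
  decay : RapidDecay f
  decay_fderiv : RapidDecay (fderiv ℝ f)

namespace RapidDecay

variable {n : ℕ} {F G : Type*} [NormedAddCommGroup F] [NormedAddCommGroup G]
  {f : ℝ × EuclideanSpace ℝ (Fin n) → F} {g : ℝ × EuclideanSpace ℝ (Fin n) → G}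

theorem mono_weight (hf : RapidDecay f) (K : ℝ) (m : ℕ)
    (h : ∀ w, ‖g w‖ ≤ K * ((1 + ‖w.2‖) ^ m * ‖f w‖)) : RapidDecay g := by
  intro N
  obtain ⟨C, hC⟩ := hf (N + m)
  refine ⟨|K| * C, fun w => ?_⟩
  calc (1 + ‖w.2‖) ^ N * ‖g w‖
      ≤ (1 + ‖w.2‖) ^ N * (|K| * ((1 + ‖w.2‖) ^ m * ‖f w‖)) := by
        gcongr
        exact (h w).trans (by gcongr; exact le_abs_self K)
    _ = |K| * ((1 + ‖w.2‖) ^ (N + m) * ‖f w‖) := by ring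
    _ ≤ |K| * C := by gcongr; exact hC w

theorem mono (hf : RapidDecay f) (K : ℝ) (h : ∀ w, ‖g w‖ ≤ K * ‖f w‖) : RapidDecay g :=
  hf.mono_weight K 0 fun w => by simpa using h w

theorem add {g : ℝ × EuclideanSpace ℝ (Fin n) → F} (hf : RapidDecay f) (hg : RapidDecay g) :
    RapidDecay fun w => f w + g w := by
  intro N
  obtain ⟨C, hC⟩ := hf N
  obtain ⟨D, hD⟩ := hg N
  refine ⟨C + D, fun w => ?_⟩
  calc (1 + ‖w.2‖) ^ N * ‖f w + g w‖ ≤ (1 + ‖w.2‖) ^ N * (‖f w‖ + ‖g w‖) := by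
        gcongr; exact norm_add_le _ _
    _ ≤ C + D := by rw [mul_add]; exact add_le_add (hC w) (hD w)

theorem bounded (hf : RapidDecay f) : ∃ B : ℝ, 0 ≤ B ∧ ∀ w, ‖f w‖ ≤ B := by
  obtain ⟨C, hC⟩ := hf 0
  simp only [pow_zero, one_mul] at hC
  exact ⟨C, (norm_nonneg _).trans (hC 0), hC⟩

theorem of_exp_bound {C γ : ℝ} (hγ : 0 < γ)
    (h : ∀ w, ‖f w‖ ≤ C * Real.exp (-γ * ‖w.2‖)) : RapidDecay f := by
  have hC : 0 ≤ C := by simpa using (norm_nonneg _).trans (h 0)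
  intro N
  refine ⟨C * (Real.exp γ * N.factorial / γ ^ N), fun w => ?_⟩
  have hexp := Real.pow_div_factorial_le_exp (γ * (1 + ‖w.2‖)) (by positivity) N
  have key : (1 + ‖w.2‖) ^ N * Real.exp (-γ * ‖w.2‖) ≤ Real.exp γ * N.factorial / γ ^ N := by
    rw [div_le_iff₀ (by positivity), mul_pow, mul_add, mul_one, Real.exp_add] at hexp
    rw [le_div_iff₀ (by positivity)]
    calc (1 + ‖w.2‖) ^ N * Real.exp (-γ * ‖w.2‖) * γ ^ N
        = γ ^ N * (1 + ‖w.2‖) ^ N * Real.exp (-γ * ‖w.2‖) := by ring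
      _ ≤ Real.exp γ * Real.exp (γ * ‖w.2‖) * N.factorial * Real.exp (-γ * ‖w.2‖) := by gcongr
      _ = Real.exp γ * N.factorial * (Real.exp (γ * ‖w.2‖) * Real.exp (-γ * ‖w.2‖)) := by ring
      _ = Real.exp γ * N.factorial := by rw [← Real.exp_add]; simp
  calc (1 + ‖w.2‖) ^ N * ‖f w‖ ≤ (1 + ‖w.2‖) ^ N * (C * Real.exp (-γ * ‖w.2‖)) := by
        gcongr; exact h w
    _ = C * ((1 + ‖w.2‖) ^ N * Real.exp (-γ * ‖w.2‖)) := by ring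
    _ ≤ _ := by gcongr

theorem exists_integrable_bound (hf : RapidDecay f) :
    ∃ b : EuclideanSpace ℝ (Fin n) → ℝ, Integrable b ∧ ∀ w, ‖f w‖ ≤ b w.2 := by
  obtain ⟨C, hC⟩ := hf (n + 1)
  refine ⟨fun x => C * (1 + ‖x‖) ^ (-((n : ℝ) + 1)), ?_, fun w => ?_⟩
  · refine (integrable_one_add_norm ?_).const_mul C
    simp
  · have h1 : (0 : ℝ) < 1 + ‖w.2‖ := by positivity
    have := hC w
    beta_reduce
    rw [Real.rpow_neg h1.le, ← div_eq_mul_inv, le_div_iff₀ (by positivity), mul_comm]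
    exact_mod_cast this

theorem integrable (hf : RapidDecay f) (hc : Continuous f) (t : ℝ) :
    Integrable fun x => f (t, x) := by
  obtain ⟨b, hb, hfb⟩ := hf.exists_integrable_bound
  exact hb.mono' (by fun_prop) (.of_forall fun x => hfb (t, x))

end RapidDecay

namespace RapidDecayC1

variable {n : ℕ} {F : Type*} [NormedAddCommGroup F] [NormedSpace ℝ F]
  {f g : ℝ × EuclideanSpace ℝ (Fin n) → F}

theorem differentiable (hf : RapidDecayC1 f) : Differentiable ℝ f :=
  hf.contDiff.differentiable one_ne_zero

theorem continuous_fderiv_apply (hf : RapidDecayC1 f) (v : ℝ × EuclideanSpace ℝ (Fin n)) :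
    Continuous fun w => fderiv ℝ f w v :=
  (hf.contDiff.continuous_fderiv one_ne_zero).clm_apply continuous_const

theorem decay_fderiv_apply (hf : RapidDecayC1 f) (v : ℝ × EuclideanSpace ℝ (Fin n)) :
    RapidDecay fun w => fderiv ℝ f w v :=
  hf.decay_fderiv.mono ‖v‖ fun w => by
    rw [mul_comm]; exact (fderiv ℝ f w).le_opNorm v

theorem integrable (hf : RapidDecayC1 f) (t : ℝ) : Integrable fun x => f (t, x) :=
  hf.decay.integrable hf.contDiff.continuous t

theorem integrable_fderiv (hf : RapidDecayC1 f) (t : ℝ) (v : ℝ × EuclideanSpace ℝ (Fin n)) :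
    Integrable fun x => fderiv ℝ f (t, x) v :=
  (hf.decay_fderiv_apply v).integrable (hf.continuous_fderiv_apply v) t

theorem of_fderiv_le (hc : ContDiff ℝ 1 f) (hd : RapidDecay f)
    {G : Type*} [NormedAddCommGroup G] {h : ℝ × EuclideanSpace ℝ (Fin n) → G}
    (hh : RapidDecay h) (K : ℝ) (m : ℕ)
    (hle : ∀ w v, ‖fderiv ℝ f w v‖ ≤ K * ((1 + ‖w.2‖) ^ m * ‖h w‖) * ‖v‖) :
    RapidDecayC1 f :=
  ⟨hc, hd, hh.mono_weight |K| m fun w =>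
    ContinuousLinearMap.opNorm_le_bound _ (by positivity) fun v =>
      (hle w v).trans (by gcongr; exact le_abs_self K)⟩

theorem add (hf : RapidDecayC1 f) (hg : RapidDecayC1 g) :
    RapidDecayC1 fun w => f w + g w := by
  refine ⟨hf.contDiff.add hg.contDiff, hf.decay.add hg.decay, ?_⟩
  have : fderiv ℝ (fun w => f w + g w) = fun w => fderiv ℝ f w + fderiv ℝ g w :=
    funext fun w => fderiv_fun_add (hf.differentiable w) (hg.differentiable w)
  rw [this]
  exact hf.decay_fderiv.add hg.decay_fderiv

theorem const_smul {R : Type*} [NormedField R] [NormedAlgebra ℝ R] [NormedSpace R F]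
    [SMulCommClass ℝ R F] (hf : RapidDecayC1 f) (c : R) : RapidDecayC1 fun w => c • f w := by
  refine ⟨hf.contDiff.const_smul c, hf.decay.mono ‖c‖ fun w => (norm_smul c _).le, ?_⟩
  have : fderiv ℝ (fun w => c • f w) = fun w => c • fderiv ℝ f w :=
    funext fun w => fderiv_fun_const_smul (hf.differentiable w) c
  rw [this]
  exact hf.decay_fderiv.mono ‖c‖ fun w => (norm_smul c _).le

theorem zero : RapidDecayC1 fun _ : ℝ × EuclideanSpace ℝ (Fin n) => (0 : F) :=
  ⟨contDiff_const, fun _ => ⟨0, by simp⟩, fun _ => ⟨0, by simp⟩⟩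

theorem sum {ι : Type*} (s : Finset ι) {f : ι → ℝ × EuclideanSpace ℝ (Fin n) → F}
    (hf : ∀ i, RapidDecayC1 (f i)) : RapidDecayC1 fun w => ∑ i ∈ s, f i w := by
  classical
  induction s using Finset.induction_on with
  | empty => simpa using zero
  | insert a s ha ih =>
    simp only [Finset.sum_insert ha]
    exact (hf a).add ih

theorem inner {f g : ℝ × EuclideanSpace ℝ (Fin n) → ℂ} (hf : RapidDecayC1 f)
    (hg : RapidDecayC1 g) : RapidDecayC1 fun w => Inner.inner ℝ (f w) (g w) := by
  obtain ⟨A, hA, hfA⟩ := hf.decay.bounded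
  obtain ⟨B, hB, hgB⟩ := hg.decay.bounded
  have hsum : RapidDecay fun w => A * ‖fderiv ℝ g w‖ + B * ‖fderiv ℝ f w‖ :=
    (hg.decay_fderiv.mono A fun w => by simp [abs_of_nonneg hA]).add
      (hf.decay_fderiv.mono B fun w => by simp [abs_of_nonneg hB])
  refine of_fderiv_le (hf.contDiff.inner ℝ hg.contDiff)
    (hg.decay.mono A fun w => (norm_inner_le_norm _ _).trans (by gcongr; exact hfA w))
    hsum 1 0 fun w v => ?_
  rw [fderiv_inner_apply ℝ (hf.differentiable w) (hg.differentiable w), Real.norm_of_nonneg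
    (by positivity : 0 ≤ A * ‖fderiv ℝ g w‖ + B * ‖fderiv ℝ f w‖), pow_zero, one_mul, one_mul,
    add_mul]
  refine (norm_add_le _ _).trans (add_le_add ?_ ?_)
  · refine (norm_inner_le_norm _ _).trans ?_
    rw [mul_assoc]
    gcongr
    · exact hfA w
    · exact (fderiv ℝ g w).le_opNorm v
  · refine (norm_inner_le_norm _ _).trans ?_
    rw [mul_assoc, mul_comm]
    gcongr
    · exact hgB w
    · exact (fderiv ℝ f w).le_opNorm v

theorem fderiv_coord_mul {f : ℝ × EuclideanSpace ℝ (Fin n) → ℝ} (hf : Differentiable ℝ f)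
    (k : Fin n) (w v : ℝ × EuclideanSpace ℝ (Fin n)) :
    fderiv ℝ (fun w => w.2 k * f w) w v = w.2 k * fderiv ℝ f w v + v.2 k * f w := by
  have hk : HasFDerivAt (fun w : ℝ × EuclideanSpace ℝ (Fin n) => w.2 k)
      ((EuclideanSpace.proj k).comp (ContinuousLinearMap.snd ℝ ℝ _)) w :=
    ((EuclideanSpace.proj k).comp (ContinuousLinearMap.snd ℝ ℝ _)).hasFDerivAt
  rw [(hk.fun_mul (hf w).hasFDerivAt).fderiv]
  simp [mul_comm]

theorem coord_mul {f : ℝ × EuclideanSpace ℝ (Fin n) → ℝ} (hf : RapidDecayC1 f) (k : Fin n) :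
    RapidDecayC1 fun w => w.2 k * f w := by
  have hk (x : EuclideanSpace ℝ (Fin n)) : ‖x k‖ ≤ ‖x‖ := PiLp.norm_apply_le x k
  have hsum : RapidDecay fun w => ‖fderiv ℝ f w‖ + ‖f w‖ :=
    (hf.decay_fderiv.mono 1 fun w => by simp).add (hf.decay.mono 1 fun w => by simp)
  refine of_fderiv_le (ContDiff.mul (by fun_prop) hf.contDiff)
    (hf.decay.mono_weight 1 1 fun w => ?_) hsum 1 1 fun w v => ?_
  · rw [norm_mul, one_mul, pow_one]
    gcongr
    linarith [hk w.2]
  · rw [fderiv_coord_mul hf.differentiable, Real.norm_of_nonneg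
      (by positivity : 0 ≤ ‖fderiv ℝ f w‖ + ‖f w‖), one_mul, pow_one]
    refine (norm_add_le _ _).trans ?_
    rw [norm_mul, norm_mul]
    have h1 := (fderiv ℝ f w).le_opNorm v
    have h2 := (hk v.2).trans (norm_snd_le v)
    have h3 := hk w.2
    calc ‖w.2 k‖ * ‖fderiv ℝ f w v‖ + ‖v.2 k‖ * ‖f w‖
        ≤ ‖w.2‖ * (‖fderiv ℝ f w‖ * ‖v‖) + ‖v‖ * ‖f w‖ := by gcongr
      _ ≤ (1 + ‖w.2‖) * (‖fderiv ℝ f w‖ + ‖f w‖) * ‖v‖ := by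
        have : 0 ≤ ‖fderiv ℝ f w‖ * ‖v‖ + ‖w.2‖ * ‖f w‖ * ‖v‖ := by positivity
        nlinarith

theorem norm_rpow {f : ℝ × EuclideanSpace ℝ (Fin n) → ℂ} (hf : RapidDecayC1 f) {q : ℝ}
    (hq : 1 < q) : RapidDecayC1 fun w => ‖f w‖ ^ q := by
  obtain ⟨B, hB, hfB⟩ := hf.decay.bounded
  refine of_fderiv_le (hf.contDiff.norm_rpow hq) (hf.decay.mono (B ^ (q - 1)) fun w => ?_)
    hf.decay_fderiv (q * B ^ (q - 1)) 0 fun w v => ?_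
  · rw [Real.norm_of_nonneg (by positivity)]
    calc ‖f w‖ ^ q = ‖f w‖ ^ (q - 1 + 1) := by ring_nf
      _ = ‖f w‖ ^ (q - 1) * ‖f w‖ := by
        rw [Real.rpow_add_one' (norm_nonneg _) (by linarith)]
      _ ≤ B ^ (q - 1) * ‖f w‖ := by
        gcongr
        exact hfB w
  · refine (ContinuousLinearMap.le_opNorm _ v).trans ?_
    rw [pow_zero, one_mul]
    gcongr
    refine (norm_fderiv_norm_rpow_le hf.differentiable hq).trans ?_
    gcongr
    exact hfB w

theorem hasFDerivAt_slice (hf : Differentiable ℝ f) (t : ℝ) (x : EuclideanSpace ℝ (Fin n)) :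
    HasFDerivAt (fun y => f (t, y))
      ((fderiv ℝ f (t, x)).comp (ContinuousLinearMap.inr ℝ ℝ _)) x :=
  (hf (t, x)).hasFDerivAt.comp x (hasFDerivAt_prodMk_right t x)

theorem fderiv_slice (hf : Differentiable ℝ f) (t : ℝ) (x v : EuclideanSpace ℝ (Fin n)) :
    fderiv ℝ (fun y => f (t, y)) x v = fderiv ℝ f (t, x) (0, v) := by
  rw [(hasFDerivAt_slice hf t x).fderiv]; simp

theorem hasDerivAt_slice (hf : Differentiable ℝ f) (t : ℝ) (x : EuclideanSpace ℝ (Fin n)) :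
    HasDerivAt (fun s => f (s, x)) (fderiv ℝ f (t, x) (1, 0)) t := by
  have := (hf (t, x)).hasFDerivAt.comp_hasDerivAt t
    ((hasDerivAt_id t).prodMk (hasDerivAt_const t x))
  simpa using! this

theorem integral_fderiv_eq_zero {f : ℝ × EuclideanSpace ℝ (Fin n) → ℝ} (hf : RapidDecayC1 f)
    (t : ℝ) (v : EuclideanSpace ℝ (Fin n)) : ∫ x, fderiv ℝ f (t, x) (0, v) = 0 := by
  have hd : Differentiable ℝ fun y => f (t, y) :=
    fun x => (hasFDerivAt_slice hf.differentiable t x).differentiableAt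
  have := integral_mul_fderiv_eq_neg_fderiv_mul_of_integrable (μ := volume)
    (f := fun _ : EuclideanSpace ℝ (Fin n) => (1 : ℝ)) (g := fun y => f (t, y)) (v := v)
    (by simp) (by simpa [fderiv_slice hf.differentiable] using hf.integrable_fderiv t (0, v))
    (by simpa using hf.integrable t) (fun x _ => by fun_prop) (fun x _ => hd x)
  simpa [fderiv_slice hf.differentiable] using this

theorem hasDerivAt_integral {f : ℝ × EuclideanSpace ℝ (Fin n) → ℝ} (hf : RapidDecayC1 f)
    (t : ℝ) : HasDerivAt (fun s => ∫ x, f (s, x)) (∫ x, fderiv ℝ f (t, x) (1, 0)) t := by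
  obtain ⟨b, hb, hfb⟩ := (hf.decay_fderiv_apply (1, 0)).exists_integrable_bound
  exact (hasDerivAt_integral_of_dominated_loc_of_deriv_le
    (F := fun s x => f (s, x)) (F' := fun s x => fderiv ℝ f (s, x) (1, 0)) Filter.univ_mem
    (.of_forall fun s => (hf.integrable s).aestronglyMeasurable) (hf.integrable t)
    (hf.integrable_fderiv t _).aestronglyMeasurable
    (.of_forall fun x s _ => hfb (s, x)) hb
    (.of_forall fun x s _ => hasDerivAt_slice hf.differentiable s x)).2

/-- Integrated form of a balance law `∂ₜ f = div F + r`. -/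
theorem hasDerivAt_integral_of_balance {f r : ℝ × EuclideanSpace ℝ (Fin n) → ℝ}
    {F : Fin n → ℝ × EuclideanSpace ℝ (Fin n) → ℝ} (hf : RapidDecayC1 f)
    (hF : ∀ j, RapidDecayC1 (F j)) (hr : RapidDecayC1 r)
    (h : ∀ w, fderiv ℝ f w (1, 0)
      = (∑ j, fderiv ℝ (F j) w (0, EuclideanSpace.single j 1)) + r w) (t : ℝ) :
    HasDerivAt (fun s => ∫ x, f (s, x)) (∫ x, r (t, x)) t := by
  convert hf.hasDerivAt_integral t using 1
  simp only [h]
  rw [integral_add (integrable_finsetSum _ fun j _ => (hF j).integrable_fderiv t _)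
    (hr.integrable t), integral_finsetSum _ fun j _ => (hF j).integrable_fderiv t _]
  simp [(hF _).integral_fderiv_eq_zero]

end RapidDecayC1

/-- Rapidly decaying solution of the focusing NLS, as a function on space-time. -/
structure IsLocalizedSolution {n : ℕ} (p : ℝ) (U : ℝ × EuclideanSpace ℝ (Fin n) → ℂ) :
    Prop where
  decay : RapidDecayC1 U
  decay_deriv : ∀ v, RapidDecayC1 fun w => fderiv ℝ U w v
  symm : ∀ w v v', fderiv ℝ (fun w => fderiv ℝ U w v) w v'
    = fderiv ℝ (fun w => fderiv ℝ U w v') w v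
  eq : ∀ w, Complex.I * fderiv ℝ U w (1, 0)
    + ∑ j, fderiv ℝ (fun w => fderiv ℝ U w (0, EuclideanSpace.single j 1)) w
        (0, EuclideanSpace.single j 1)
    = -(((‖U w‖ ^ p : ℝ) : ℂ) * U w)

/-- Energy density of the focusing NLS. -/
noncomputable def energyDensity {n : ℕ} (p : ℝ) (U : ℝ × EuclideanSpace ℝ (Fin n) → ℂ)
    (w : ℝ × EuclideanSpace ℝ (Fin n)) : ℝ :=
  (∑ j, inner ℝ (fderiv ℝ U w (0, EuclideanSpace.single j 1))
    (fderiv ℝ U w (0, EuclideanSpace.single j 1))) - 2 / (p + 2) * ‖U w‖ ^ (p + 2)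

/-- Density of the virial function `Im ∫ ⟨x, ū ∇u⟩`. -/
noncomputable def virialDensity {n : ℕ} (U : ℝ × EuclideanSpace ℝ (Fin n) → ℂ)
    (w : ℝ × EuclideanSpace ℝ (Fin n)) : ℝ :=
  ∑ k, w.2 k * inner ℝ (Complex.I • U w) (fderiv ℝ U w (0, EuclideanSpace.single k 1))

namespace IsLocalizedSolution

variable {n : ℕ} {p : ℝ} {U : ℝ × EuclideanSpace ℝ (Fin n) → ℂ}

theorem decay_energyDensity (h : IsLocalizedSolution p U) (hp : 0 < p) :
    RapidDecayC1 (energyDensity p U) := by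
  have := (RapidDecayC1.sum Finset.univ fun j : Fin n =>
    (h.decay_deriv (0, EuclideanSpace.single j 1)).inner
      (h.decay_deriv (0, EuclideanSpace.single j 1))).add
    ((h.decay.norm_rpow (by linarith : 1 < p + 2)).const_smul (-(2 / (p + 2))))
  convert this using 2 with w
  simp [energyDensity, sub_eq_add_neg]

theorem decay_virialDensity (h : IsLocalizedSolution p U) :
    RapidDecayC1 (virialDensity U) :=
  RapidDecayC1.sum Finset.univ fun k =>
    ((h.decay.const_smul Complex.I).inner (h.decay_deriv _)).coord_mul k

theorem fderiv_norm_rpow_apply (h : IsLocalizedSolution p U) (hp : 0 < p)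
    (w v : ℝ × EuclideanSpace ℝ (Fin n)) :
    fderiv ℝ (fun w => ‖U w‖ ^ (p + 2)) w v
      = (p + 2) * (‖U w‖ ^ p * inner ℝ (U w) (fderiv ℝ U w v)) := by
  rw [h.decay.differentiable.fderiv_norm_rpow (by linarith : 1 < p + 2)]
  simp [mul_assoc]

theorem fderiv_energyDensity (h : IsLocalizedSolution p U) (hp : 0 < p)
    (w v : ℝ × EuclideanSpace ℝ (Fin n)) :
    fderiv ℝ (energyDensity p U) w v
      = (∑ j, 2 * inner ℝ (fderiv ℝ U w (0, EuclideanSpace.single j 1))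
          (fderiv ℝ (fun w => fderiv ℝ U w (0, EuclideanSpace.single j 1)) w v))
        - 2 * (‖U w‖ ^ p * inner ℝ (U w) (fderiv ℝ U w v)) := by
  have hd (j : Fin n) := (h.decay_deriv (0, EuclideanSpace.single j 1)).differentiable
  have hi (j : Fin n) := ((h.decay_deriv (0, EuclideanSpace.single j 1)).inner
    (h.decay_deriv (0, EuclideanSpace.single j 1))).differentiable
  have hV := (h.decay.norm_rpow (by linarith : 1 < p + 2)).differentiable
  unfold energyDensity
  rw [fderiv_fun_sub (DifferentiableAt.fun_sum fun j _ => hi j w) ((hV w).const_mul _),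
    fderiv_fun_sum fun j _ => hi j w, fderiv_const_mul (hV w)]
  simp only [_root_.sub_apply, _root_.sum_apply,
    _root_.smul_apply, h.fderiv_norm_rpow_apply hp, smul_eq_mul]
  congr 1
  · refine Finset.sum_congr rfl fun j _ => ?_
    rw [fderiv_inner_apply ℝ (hd j w) (hd j w), real_inner_comm _ (fderiv ℝ U w _)]
    ring
  · field_simp

theorem fderiv_virialDensity (h : IsLocalizedSolution p U)
    (w : ℝ × EuclideanSpace ℝ (Fin n)) :
    fderiv ℝ (virialDensity U) w (1, 0)
      = ∑ k, w.2 k * (inner ℝ (Complex.I • U w)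
          (fderiv ℝ (fun w => fderiv ℝ U w (0, EuclideanSpace.single k 1)) w (1, 0))
        + inner ℝ (Complex.I • fderiv ℝ U w (1, 0))
          (fderiv ℝ U w (0, EuclideanSpace.single k 1))) := by
  have hI := h.decay.const_smul Complex.I
  have hi (k : Fin n) := hI.inner (h.decay_deriv (0, EuclideanSpace.single k 1))
  unfold virialDensity
  rw [fderiv_fun_sum fun k _ => ((hi k).coord_mul k).differentiable w]
  simp only [_root_.sum_apply]
  refine Finset.sum_congr rfl fun k _ => ?_
  rw [RapidDecayC1.fderiv_coord_mul (hi k).differentiable,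
    fderiv_inner_apply ℝ (hI.differentiable w) ((h.decay_deriv _).differentiable w),
    fderiv_fun_const_smul (h.decay.differentiable w)]
  simp

theorem laplacian_eq (h : IsLocalizedSolution p U) (w : ℝ × EuclideanSpace ℝ (Fin n)) :
    ∑ j, fderiv ℝ (fun w => fderiv ℝ U w (0, EuclideanSpace.single j 1)) w
        (0, EuclideanSpace.single j 1)
      = -(Complex.I • fderiv ℝ U w (1, 0)) - (‖U w‖ ^ p) • U w := by
  have := h.eq w
  rw [smul_eq_mul, Complex.real_smul]
  linear_combination this

theorem inner_I_smul_left (a b : ℂ) :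
    inner ℝ (Complex.I • a) b = -inner ℝ a (Complex.I • b) := by
  simp [Complex.inner]; ring

theorem inner_I_smul_self (a : ℂ) : inner ℝ (Complex.I • a) a = 0 := by
  simp [Complex.inner]; ring

theorem energy_hasDerivAt (h : IsLocalizedSolution p U) (hp : 0 < p) (t : ℝ) :
    HasDerivAt (fun s => ∫ x, energyDensity p U (s, x)) 0 t := by
  have hd (j : Fin n) := h.decay_deriv (0, EuclideanSpace.single j 1)
  have h0 := h.decay_deriv (1, 0)
  have := RapidDecayC1.hasDerivAt_integral_of_balance (h.decay_energyDensity hp)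
    (F := fun j w => (2 : ℝ) • inner ℝ (fderiv ℝ U w (0, EuclideanSpace.single j 1))
      (fderiv ℝ U w (1, 0))) (fun j => ((hd j).inner h0).const_smul 2)
    RapidDecayC1.zero (fun w => ?_) t
  · simpa using this
  · have hF (j : Fin n) : fderiv ℝ (fun w => (2 : ℝ) • inner ℝ
        (fderiv ℝ U w (0, EuclideanSpace.single j 1)) (fderiv ℝ U w (1, 0))) w
          (0, EuclideanSpace.single j 1)
        = 2 * inner ℝ (fderiv ℝ U w (0, EuclideanSpace.single j 1))
            (fderiv ℝ (fun w => fderiv ℝ U w (0, EuclideanSpace.single j 1)) w (1, 0))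
          + 2 * inner ℝ (fderiv ℝ (fun w => fderiv ℝ U w (0, EuclideanSpace.single j 1)) w
            (0, EuclideanSpace.single j 1)) (fderiv ℝ U w (1, 0)) := by
      rw [fderiv_fun_const_smul (((hd j).inner h0).differentiable w),
        _root_.smul_apply,
        fderiv_inner_apply ℝ ((hd j).differentiable w) (h0.differentiable w),
        h.symm w (1, 0), smul_eq_mul]
      ring
    simp only [hF]
    rw [h.fderiv_energyDensity hp, Finset.sum_add_distrib, ← Finset.mul_sum, ← Finset.mul_sum,
      ← sum_inner, h.laplacian_eq, inner_sub_left, inner_neg_left, inner_I_smul_self,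
      real_inner_smul_left]
    ring

theorem virial_hasDerivAt (h : IsLocalizedSolution p U) (hp : 0 < p) (t : ℝ) :
    HasDerivAt (fun s => ∫ x, virialDensity U (s, x))
      (2 * (∫ x, energyDensity p U (t, x))
        + (4 - n * p) / (p + 2) * ∫ x, ‖U (t, x)‖ ^ (p + 2)) t := by
  have hd (j : Fin n) := h.decay_deriv (0, EuclideanSpace.single j 1)
  have h0 := h.decay_deriv (1, 0)
  have hI := h.decay.const_smul Complex.I
  have hV := h.decay.norm_rpow (by linarith : 1 < p + 2)
  have hE := h.decay_energyDensity hp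
  have hr := (hE.const_smul (2 : ℝ)).add (hV.const_smul ((4 - n * p) / (p + 2)))
  have hq := (hI.inner h0).add hE
  have hD (j : Fin n) := RapidDecayC1.sum Finset.univ fun k => ((hd j).inner (hd k)).coord_mul k
  have hUd (j : Fin n) := h.decay.inner (hd j)
  have := RapidDecayC1.hasDerivAt_integral_of_balance h.decay_virialDensity
    (fun j => (hq.coord_mul j).add
      (((hUd j).const_smul (-n : ℝ)).add ((hD j).const_smul (-2 : ℝ)))) hr (fun w => ?_) t
  · convert this using 1
    simp only [smul_eq_mul]
    rw [integral_add ((hE.integrable t).const_mul _) ((hV.integrable t).const_mul _),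
      integral_const_mul, integral_const_mul]
  · have hF (j : Fin n) : fderiv ℝ (fun w : ℝ × EuclideanSpace ℝ (Fin n) =>
        w.2 j * (inner ℝ (Complex.I • U w) (fderiv ℝ U w (1, 0)) + energyDensity p U w)
          + ((-n : ℝ) • inner ℝ (U w) (fderiv ℝ U w (0, EuclideanSpace.single j 1))
          + (-2 : ℝ) • ∑ k, w.2 k * inner ℝ (fderiv ℝ U w (0, EuclideanSpace.single j 1))
            (fderiv ℝ U w (0, EuclideanSpace.single k 1)))) w (0, EuclideanSpace.single j 1)
        = w.2 j * fderiv ℝ (fun w => inner ℝ (Complex.I • U w) (fderiv ℝ U w (1, 0))) w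
              (0, EuclideanSpace.single j 1)
          + w.2 j * fderiv ℝ (energyDensity p U) w (0, EuclideanSpace.single j 1)
          + (inner ℝ (Complex.I • U w) (fderiv ℝ U w (1, 0)) + energyDensity p U w)
          - n * fderiv ℝ (fun w => inner ℝ (U w)
              (fderiv ℝ U w (0, EuclideanSpace.single j 1))) w (0, EuclideanSpace.single j 1)
          - 2 * ∑ k, fderiv ℝ (fun w : ℝ × EuclideanSpace ℝ (Fin n) => w.2 k *
              inner ℝ (fderiv ℝ U w (0, EuclideanSpace.single j 1))
              (fderiv ℝ U w (0, EuclideanSpace.single k 1))) w (0, EuclideanSpace.single j 1) := by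
      rw [fderiv_fun_add ((hq.coord_mul j).differentiable w)
          ((((hUd j).const_smul (-n : ℝ)).add ((hD j).const_smul (-2 : ℝ))).differentiable w),
        fderiv_fun_add (((hUd j).const_smul (-n : ℝ)).differentiable w)
          (((hD j).const_smul (-2 : ℝ)).differentiable w),
        fderiv_fun_const_smul ((hUd j).differentiable w),
        fderiv_fun_const_smul ((hD j).differentiable w),
        fderiv_fun_sum fun k _ => (((hd j).inner (hd k)).coord_mul k).differentiable w]
      simp only [_root_.add_apply, _root_.smul_apply,
        _root_.sum_apply, RapidDecayC1.fderiv_coord_mul hq.differentiable]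
      rw [fderiv_fun_add ((hI.inner h0).differentiable w) (hE.differentiable w)]
      simp
      ring
    have hIq (j : Fin n) : fderiv ℝ (fun w => inner ℝ (Complex.I • U w)
          (fderiv ℝ U w (1, 0))) w (0, EuclideanSpace.single j 1)
        = inner ℝ (Complex.I • U w)
            (fderiv ℝ (fun w => fderiv ℝ U w (0, EuclideanSpace.single j 1)) w (1, 0))
          - inner ℝ (Complex.I • fderiv ℝ U w (1, 0))
            (fderiv ℝ U w (0, EuclideanSpace.single j 1)) := by
      rw [fderiv_inner_apply ℝ (hI.differentiable w) (h0.differentiable w),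
        fderiv_fun_const_smul (h.decay.differentiable w), h.symm w (1, 0),
        _root_.smul_apply, inner_I_smul_left (fderiv ℝ U w _),
        real_inner_comm (Complex.I • fderiv ℝ U w (1, 0))]
      ring
    have hUj (j : Fin n) := fderiv_inner_apply ℝ (h.decay.differentiable w)
      ((hd j).differentiable w) (0, EuclideanSpace.single j 1)
    have hjk (j k : Fin n) : fderiv ℝ (fun w : ℝ × EuclideanSpace ℝ (Fin n) => w.2 k *
            inner ℝ (fderiv ℝ U w (0, EuclideanSpace.single j 1))
            (fderiv ℝ U w (0, EuclideanSpace.single k 1))) w (0, EuclideanSpace.single j 1)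
        = w.2 k * inner ℝ (fderiv ℝ U w (0, EuclideanSpace.single j 1))
            (fderiv ℝ (fun w => fderiv ℝ U w (0, EuclideanSpace.single j 1)) w
              (0, EuclideanSpace.single k 1))
          + w.2 k * inner ℝ (fderiv ℝ (fun w => fderiv ℝ U w (0, EuclideanSpace.single j 1)) w
              (0, EuclideanSpace.single j 1)) (fderiv ℝ U w (0, EuclideanSpace.single k 1))
          + if j = k then inner ℝ (fderiv ℝ U w (0, EuclideanSpace.single j 1))
              (fderiv ℝ U w (0, EuclideanSpace.single j 1)) else 0 := by
      rw [RapidDecayC1.fderiv_coord_mul ((hd j).inner (hd k)).differentiable,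
        fderiv_inner_apply ℝ ((hd j).differentiable w) ((hd k).differentiable w),
        h.symm w (0, EuclideanSpace.single k 1)]
      by_cases hjk : j = k
      · subst hjk; simp; ring
      · simp [hjk, Ne.symm hjk]; ring
    have hlap1 : ∑ j, inner ℝ (U w)
        (fderiv ℝ (fun w => fderiv ℝ U w (0, EuclideanSpace.single j 1)) w
          (0, EuclideanSpace.single j 1))
        = inner ℝ (Complex.I • U w) (fderiv ℝ U w (1, 0)) - ‖U w‖ ^ (p + 2) := by
      rw [← inner_sum, h.laplacian_eq, inner_sub_right, inner_neg_right, inner_I_smul_left,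
        real_inner_smul_right, real_inner_self_eq_norm_sq,
        Real.rpow_add' (norm_nonneg _) (by positivity), Real.rpow_two]
    have hlap2 : ∑ j, ∑ k, w.2 k * inner ℝ
        (fderiv ℝ (fun w => fderiv ℝ U w (0, EuclideanSpace.single j 1)) w
          (0, EuclideanSpace.single j 1)) (fderiv ℝ U w (0, EuclideanSpace.single k 1))
        = -(∑ k, w.2 k * inner ℝ (Complex.I • fderiv ℝ U w (1, 0))
            (fderiv ℝ U w (0, EuclideanSpace.single k 1)))
          - ∑ k, w.2 k * (‖U w‖ ^ p * inner ℝ (U w)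
            (fderiv ℝ U w (0, EuclideanSpace.single k 1))) := by
      rw [Finset.sum_comm, ← Finset.sum_neg_distrib, ← Finset.sum_sub_distrib]
      refine Finset.sum_congr rfl fun k _ => ?_
      rw [← Finset.mul_sum, ← sum_inner, h.laplacian_eq, inner_sub_left, inner_neg_left,
        real_inner_smul_left]
      ring
    have hswap : ∑ j, w.2 j * ∑ k, inner ℝ (fderiv ℝ U w (0, EuclideanSpace.single k 1))
        (fderiv ℝ (fun w => fderiv ℝ U w (0, EuclideanSpace.single k 1)) w
          (0, EuclideanSpace.single j 1))
        = ∑ j, ∑ k, w.2 k * inner ℝ (fderiv ℝ U w (0, EuclideanSpace.single j 1))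
          (fderiv ℝ (fun w => fderiv ℝ U w (0, EuclideanSpace.single j 1)) w
            (0, EuclideanSpace.single k 1)) := by
      rw [Finset.sum_comm]
      simp only [Finset.mul_sum]
    simp only [hF, hIq, hUj, hjk, h.fderiv_energyDensity hp, h.fderiv_virialDensity]
    simp only [mul_add, mul_sub, Finset.sum_add_distrib, Finset.sum_sub_distrib,
      ← Finset.mul_sum, Finset.sum_ite_eq, Finset.mem_univ, if_true, Finset.sum_const,
      Finset.card_univ, Fintype.card_fin, nsmul_eq_mul, mul_left_comm _ (2 : ℝ), hlap1, hlap2,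
      hswap, smul_eq_mul]
    have hc : (4 - n * p) / (p + 2) = (2 + n) * (2 / (p + 2)) - n := by
      field_simp
      ring
    rw [energyDensity, hc]
    ring

end IsLocalizedSolution

theorem IsLocalizedSolution.of_exp_bound {n : ℕ} {p : ℝ}
    {u : ℝ → EuclideanSpace ℝ (Fin n) → ℂ}
    (hsmooth : ContDiff ℝ (⊤ : ℕ∞) (Function.uncurry u))
    (heq : ∀ (t : ℝ) (x : EuclideanSpace ℝ (Fin n)),
      Complex.I * deriv (fun s => u s x) t + lap (u t) x
        = -(((‖u t x‖ ^ p : ℝ) : ℂ) * u t x))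
    {C γ : ℝ} (hγ : 0 < γ)
    (hloc : ∀ k : ℕ, k ≤ 2 → ∀ (t : ℝ) (x : EuclideanSpace ℝ (Fin n)),
      ‖iteratedFDeriv ℝ k (Function.uncurry u) (t, x)‖ ≤ C * Real.exp (-γ * ‖x‖)) :
    IsLocalizedSolution p (Function.uncurry u) := by
  have htwo : (2 : WithTop ℕ∞) ≤ ((⊤ : ℕ∞) : WithTop ℕ∞) :=
    WithTop.coe_le_coe.mpr (le_top : (2 : ℕ∞) ≤ ⊤)
  have hd0 : RapidDecay (Function.uncurry u) := .of_exp_bound hγ fun w => by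
    simpa using hloc 0 (by norm_num) w.1 w.2
  have hd1 : RapidDecay (fderiv ℝ (Function.uncurry u)) := .of_exp_bound hγ fun w => by
    simpa [norm_iteratedFDeriv_one] using hloc 1 (by norm_num) w.1 w.2
  have hd2 : RapidDecay (fderiv ℝ (fderiv ℝ (Function.uncurry u))) :=
    .of_exp_bound hγ fun w => by
      have := hloc 2 le_rfl w.1 w.2
      rwa [← norm_iteratedFDeriv_fderiv, norm_iteratedFDeriv_one] at this
  have hc1 : ContDiff ℝ 1 (fderiv ℝ (Function.uncurry u)) :=
    hsmooth.fderiv_right (by simpa [one_add_one_eq_two] using htwo)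
  have hdiff : Differentiable ℝ (fderiv ℝ (Function.uncurry u)) :=
    hc1.differentiable one_ne_zero
  have hsnd (w v v' : ℝ × EuclideanSpace ℝ (Fin n)) :
      fderiv ℝ (fun w => fderiv ℝ (Function.uncurry u) w v) w v'
        = fderiv ℝ (fderiv ℝ (Function.uncurry u)) w v' v := by
    rw [fderiv_clm_apply (hdiff w) (differentiableAt_const v)]
    simp
  have hD : RapidDecayC1 (Function.uncurry u) :=
    ⟨hsmooth.of_le (by exact_mod_cast le_top), hd0, hd1⟩
  have hDv (v : ℝ × EuclideanSpace ℝ (Fin n)) :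
      RapidDecayC1 fun w => fderiv ℝ (Function.uncurry u) w v :=
    .of_fderiv_le (hc1.clm_apply contDiff_const) (hD.decay_fderiv_apply v) hd2 ‖v‖ 0
      fun w v' => by
        rw [hsnd, pow_zero, one_mul]
        calc _ ≤ _ := ContinuousLinearMap.le_opNorm₂ _ v' v
          _ = _ := by ring
  refine ⟨hD, hDv, fun w v v' => ?_, fun w => ?_⟩
  · rw [hsnd, hsnd]
    exact (hsmooth.contDiffAt.isSymmSndFDerivAt (by simpa using htwo)) v' v
  · obtain ⟨t, x⟩ := w
    have h := heq t x
    have hdt : deriv (fun s => u s x) t = fderiv ℝ (Function.uncurry u) (t, x) (1, 0) :=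
      (RapidDecayC1.hasDerivAt_slice hD.differentiable t x).deriv
    rw [hdt] at h
    have hpd (j : Fin n) : (fun y => pd (u t) j y) = fun y =>
        fderiv ℝ (Function.uncurry u) (t, y) (0, EuclideanSpace.single j 1) :=
      funext fun y => RapidDecayC1.fderiv_slice hD.differentiable t y _
    simp only [lap, hpd] at h
    simp only [pd, RapidDecayC1.fderiv_slice (hDv _).differentiable] at h
    exact h

theorem exists_hasDerivAt_eq_zero_of_periodic {f f' : ℝ → ℝ} (hf : ∀ t, HasDerivAt f (f' t) t)
    {T : ℝ} (hT : 0 < T) (hper : ∀ t, f (t + T) = f t) : ∃ t, f' t = 0 := by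
  obtain ⟨t, -, ht⟩ := exists_hasDerivAt_eq_zero hT
    (fun t _ => (hf t).continuousAt.continuousWithinAt) (by simpa using (hper 0).symm)
    fun t _ => hf t
  exact ⟨t, ht⟩

theorem Monotone.eq_const_of_periodic {f : ℝ → ℝ} (hf : Monotone f) {T : ℝ} (hT : 0 < T)
    (hper : Function.Periodic f T) (a b : ℝ) : f a = f b := by
  suffices H : ∀ a b, f b ≤ f a from le_antisymm (H b a) (H a b)
  intro a b
  obtain ⟨k, hk⟩ := exists_nat_ge ((b - a) / T)
  rw [div_le_iff₀ hT] at hk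
  calc f b ≤ f (a + k * T) := hf (by linarith)
    _ = f a := hper.nat_mul k a

theorem eq_zero_of_periodic_of_nonneg {f f' : ℝ → ℝ} (hf : ∀ t, HasDerivAt f (f' t) t)
    {T : ℝ} (hT : 0 < T) (hper : Function.Periodic f T) (hnn : ∀ t, 0 ≤ f' t) (t : ℝ) :
    f' t = 0 := by
  have hmono : Monotone f := monotone_of_hasDerivAt_nonneg hf hnn
  have hconst : f = fun _ => f 0 :=
    funext fun s => hmono.eq_const_of_periodic hT hper s 0
  have := hf t
  rw [hconst] at this
  exact this.unique (hasDerivAt_const t _)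

/-- **Nonexistence of breathers for the focusing NLS.**
There is no smooth, exponentially localized, time-periodic solution of
`i ∂ₜ u + Δ u = -|u|^p u` (with `0 < p < p_n*`) with vanishing momentum lying in
one of the regimes (1) `E > 0` and `p ≤ 4/n`, (2) `E = 0`, `p ≠ 4/n` and `u ≠ 0`,
(3) `E < 0` and `4/n ≤ p`. -/
theorem no_focusing_NLS_breather (n : ℕ) (hn : 1 ≤ n) (p : ℝ) (hp : 0 < p)
    (hpcrit : 3 ≤ n → p < 4 / ((n : ℝ) - 2))
    (u : ℝ → EuclideanSpace ℝ (Fin n) → ℂ)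
    (hsmooth : ContDiff ℝ (⊤ : ℕ∞) (Function.uncurry u))
    (heq : ∀ (t : ℝ) (x : EuclideanSpace ℝ (Fin n)),
      Complex.I * deriv (fun s => u s x) t + lap (u t) x
        = -(((‖u t x‖ ^ p : ℝ) : ℂ) * u t x))
    (hloc : ∃ C > 0, ∃ γ > 0, ∀ k : ℕ, k ≤ 2 → ∀ (t : ℝ) (x : EuclideanSpace ℝ (Fin n)),
      ‖iteratedFDeriv ℝ k (Function.uncurry u) (t, x)‖ ≤ C * Real.exp (-γ * ‖x‖))
    (hper : ∃ T > 0, ∀ (t : ℝ) (x : EuclideanSpace ℝ (Fin n)), u (t + T) x = u t x)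
    (hmom : ∀ j : Fin n, (∫ x, pd (u 0) j x * (starRingEnd ℂ) (u 0 x)).im = 0)
    (hreg : (0 < focusingEnergy p u ∧ p ≤ 4 / (n : ℝ)) ∨
            (focusingEnergy p u = 0 ∧ p ≠ 4 / (n : ℝ) ∧ ¬ (∀ t x, u t x = 0)) ∨
            (focusingEnergy p u < 0 ∧ 4 / (n : ℝ) ≤ p)) :
    False := by
  obtain ⟨C, -, γ, hγ, hloc⟩ := hloc
  obtain ⟨T, hT, hper⟩ := hper
  have h : IsLocalizedSolution p (Function.uncurry u) := .of_exp_bound hsmooth heq hγ hloc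
  have hn0 : (0 : ℝ) < n := by exact_mod_cast hn
  have hp2 : 0 < p + 2 := by linarith
  have hVdecay := h.decay.norm_rpow (by linarith : 1 < p + 2)
  have hE0 : ∫ x, energyDensity p (Function.uncurry u) (0, x) = focusingEnergy p u := by
    have hK := RapidDecayC1.sum Finset.univ fun j : Fin n =>
      (h.decay_deriv (0, EuclideanSpace.single j 1)).inner
        (h.decay_deriv (0, EuclideanSpace.single j 1))
    simp only [energyDensity]
    rw [integral_sub (hK.integrable 0) ((hVdecay.integrable 0).const_mul _),
      integral_const_mul, focusingEnergy]
    have hpd (j : Fin n) (x : EuclideanSpace ℝ (Fin n)) : pd (u 0) j x =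
        fderiv ℝ (Function.uncurry u) (0, x) (0, EuclideanSpace.single j 1) :=
      RapidDecayC1.fderiv_slice h.decay.differentiable 0 x _
    simp only [hpd, real_inner_self_eq_norm_sq]
    rfl
  have hE (t : ℝ) : ∫ x, energyDensity p (Function.uncurry u) (t, x) = focusingEnergy p u := by
    rw [← hE0]
    exact is_const_of_deriv_eq_zero (fun s => (h.energy_hasDerivAt hp s).differentiableAt)
      (fun s => (h.energy_hasDerivAt hp s).deriv) t 0
  have hV (t : ℝ) : 0 ≤ ∫ x, ‖Function.uncurry u (t, x)‖ ^ (p + 2) :=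
    integral_nonneg fun x => by positivity
  have hM (t : ℝ) := h.virial_hasDerivAt hp t
  simp only [hE] at hM
  have hshift (w v : ℝ × EuclideanSpace ℝ (Fin n)) :
      fderiv ℝ (Function.uncurry u) (w + (T, 0)) v = fderiv ℝ (Function.uncurry u) w v := by
    rw [← fderiv_comp_add_right]
    congr 2
    funext w
    simpa [Function.uncurry_def] using hper w.1 w.2
  have hMper : Function.Periodic
      (fun s => ∫ x, virialDensity (Function.uncurry u) (s, x)) T := by
    intro t
    refine integral_congr_ae (.of_forall fun x => ?_)
    have hw (v : ℝ × EuclideanSpace ℝ (Fin n)) : fderiv ℝ (Function.uncurry u) (t + T, x) v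
        = fderiv ℝ (Function.uncurry u) (t, x) v := by
      simpa using hshift (t, x) v
    simp only [virialDensity, hw, Function.uncurry_apply_pair, hper]
  rcases hreg with ⟨hpos, hle⟩ | ⟨hzero, hne, hu⟩ | ⟨hneg, hge⟩
  · rw [le_div_iff₀ hn0] at hle
    obtain ⟨t, ht⟩ := exists_hasDerivAt_eq_zero_of_periodic hM hT hMper
    have : 0 ≤ (4 - n * p) / (p + 2) := div_nonneg (by linarith) hp2.le
    linarith [mul_nonneg this (hV t)]
  · have hc : (4 - n * p) / (p + 2) ≠ 0 := by
      refine div_ne_zero (fun h4 => hne ?_) hp2.ne'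
      rw [eq_div_iff hn0.ne']
      linarith
    have hV0 (t : ℝ) : ∫ x, ‖Function.uncurry u (t, x)‖ ^ (p + 2) = 0 := by
      have hsq := eq_zero_of_periodic_of_nonneg
        (fun t => (hM t).const_mul ((4 - n * p) / (p + 2))) hT
        (fun t => by simpa using Or.inl (hMper t)) (fun t => ?_) t
      · rw [hzero, mul_zero, zero_add, ← mul_assoc] at hsq
        exact (mul_eq_zero.mp hsq).resolve_left (mul_ne_zero hc hc)
      · rw [hzero, mul_zero, zero_add, ← mul_assoc]
        exact mul_nonneg (mul_self_nonneg _) (hV t)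
    refine hu fun t x => ?_
    have hcont : Continuous fun x => ‖Function.uncurry u (t, x)‖ ^ (p + 2) :=
      hVdecay.contDiff.continuous.comp (by fun_prop : Continuous fun x => (t, x))
    have hae := (integral_eq_zero_iff_of_nonneg (fun x => by positivity)
      (hVdecay.integrable t)).mp (hV0 t)
    have hx := congrFun ((hcont.ae_eq_iff_eq volume continuous_const).mp hae) x
    exact norm_eq_zero.mp ((Real.rpow_eq_zero (norm_nonneg _) hp2.ne').mp hx)
  · rw [div_le_iff₀ hn0] at hge
    obtain ⟨t, ht⟩ := exists_hasDerivAt_eq_zero_of_periodic hM hT hMper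
    have : (4 - n * p) / (p + 2) ≤ 0 := div_nonpos_of_nonpos_of_nonneg (by linarith) hp2.le
    linarith [mul_nonpos_of_nonpos_of_nonneg this (hV t)]
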